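/- Let A_Z be a finite-dimensional factor generated by subsystems A_A, A_B, A_C indexed by three pairwise disjoint regions of a graded quantum system, so that A_AB, A_BC, A_B satisfy the commuting square condition and the matrix trace on the algebra of a union of disjoint regions is the product of the matrix traces of the factors. Then for every state ψ on A_Z, the von Neumann entropy S satisfies S(ψ) − S(ψ|_{A_AB}) − S(ψ|_{A_BC}) + S(ψ|_{A_B}) ≤ 0. -/

import Mathlib

open scoped ComplexOrder

/-- The full matrix algebra `M_N(ℂ)`, our model of a finite-dimensional factor. -/
abbrev Mat (N : ℕ) := Matrix (Fin N) (Fin N) ℂ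

variable {N : ℕ}

/-- The tracial state `τ` on `Mat N`. -/
noncomputable def tau (x : Mat N) : ℂ := x.trace / N

/-- Matrix logarithm via the continuous functional calculus. -/
noncomputable def mlog (x : Mat N) : Mat N := cfc Real.log x

/-- Matrix square root via the continuous functional calculus. -/
noncomputable def msqrt (x : Mat N) : Mat N := cfc Real.sqrt x

/-- Matrix inverse square root via the continuous functional calculus. -/
noncomputable def misqrt (x : Mat N) : Mat N := cfc (fun t : ℝ => (Real.sqrt t)⁻¹) x

/-- The entropy `Ŝ(ψ) = -ψ(log ρ_ψ) = -τ(ρ log ρ)` of the state with τ-density `ρ`. -/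
noncomputable def Shat (ρ : Mat N) : ℝ := -(tau (ρ * mlog ρ)).re

/-- The von Neumann entropy `S(ψ|_B) = -Tr_B(D log D) = Ŝ(ψ|_B) + log k` of the
restriction of a state to a subfactor `B ≅ M_k`, expressed through the τ-density `ρ`
of the restriction and the matrix size `k` of the subfactor. -/
noncomputable def Sres (ρ : Mat N) (k : ℕ) : ℝ := Shat ρ + Real.log k

/-- `ρ` is the density with respect to the tracial state `τ` of a state of `Mat N`. -/
def IsTauDensity (ρ : Mat N) : Prop := ρ.PosSemidef ∧ tau ρ = 1

/-- `E` is the τ-preserving conditional expectation onto the unital *-subalgebra `B`: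
it maps into `B`, fixes `B` pointwise, and `Tr(b x) = Tr(b (E x))` for all `b ∈ B`.
These properties determine `E` uniquely. -/
def IsCondExp (B : StarSubalgebra ℂ (Mat N)) (E : Mat N →ₗ[ℂ] Mat N) : Prop :=
  (∀ x, E x ∈ B) ∧ (∀ b ∈ B, E b = b) ∧
    (∀ x : Mat N, ∀ b ∈ B, (b * x).trace = (b * E x).trace)

/-- `B` is a subfactor: its relative center is trivial (so `B` is a full matrix algebra). -/
def IsFactorSub (B : StarSubalgebra ℂ (Mat N)) : Prop :=
  ∀ x ∈ B, (∀ y ∈ B, x * y = y * x) → ∃ c : ℂ, x = c • (1 : Mat N)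

/-- The commuting square condition: `B = AB ⊓ BC` and `E_AB ∘ E_BC = E_BC ∘ E_AB = E_B`. -/
def CommSquare (AB BC B : StarSubalgebra ℂ (Mat N))
    (EAB EBC EB : Mat N →ₗ[ℂ] Mat N) : Prop :=
  IsCondExp AB EAB ∧ IsCondExp BC EBC ∧ IsCondExp B EB ∧
    B = AB ⊓ BC ∧ (∀ x, EAB (EBC x) = EB x) ∧ (∀ x, EBC (EAB x) = EB x)

open Classical in
/-- Relative entropy `H(ρ₁, ρ₂) = τ(ρ₁ (log ρ₁ - log ρ₂))` of two τ-densities, equal to `+∞`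
unless the support of `ρ₁` is dominated by the support of `ρ₂` (for positive semidefinite
matrices the support condition is the inclusion of kernels `ker ρ₂ ⊆ ker ρ₁`). -/
noncomputable def relEnt (ρ₁ ρ₂ : Mat N) : EReal :=
  if ∀ v : Fin N → ℂ, ρ₂.mulVec v = 0 → ρ₁.mulVec v = 0 then
    (((tau (ρ₁ * (mlog ρ₁ - mlog ρ₂))).re : ℝ) : EReal)
  else ⊤

/-- Complete positivity of a linear map on `Mat N`. -/
def IsCP (E : Mat N →ₗ[ℂ] Mat N) : Prop :=
  ∀ (k : ℕ) (x a : Fin k → Mat N),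
    (∑ i, ∑ j, star (a i) * E (star (x i) * x j) * a j).PosSemidef

/-- `p` is a minimal projection of the subalgebra `B`. -/
def IsMinProj (B : StarSubalgebra ℂ (Mat N)) (p : Mat N) : Prop :=
  p ∈ B ∧ p.IsHermitian ∧ p * p = p ∧ p ≠ 0 ∧
    ∀ q ∈ B, q.IsHermitian → q * q = q → q * p = q → q = 0 ∨ q = p

/-- The subfactor `B` of `Mat N` has matrix size `k` (i.e. `B ≅ M_k`) in the sense that its
minimal projections have ambient matrix trace `N / k`; this encodes the assumption that the
ambient matrix trace restricts on `B` to `N/k` times the canonical matrix trace of `B`. -/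
def HasMatSize (B : StarSubalgebra ℂ (Mat N)) (k : ℕ) : Prop :=
  ∀ p, IsMinProj B p → Matrix.trace p = ((N : ℂ) / k)

/-- `Θ` is a grading: an involutive *-automorphism. -/
def IsGrading (Θ : Mat N ≃⋆ₐ[ℂ] Mat N) : Prop := ∀ x, Θ (Θ x) = x

/-- The subalgebra `A` is invariant under the grading. -/
def ThetaInvariant (Θ : Mat N ≃⋆ₐ[ℂ] Mat N) (A : StarSubalgebra ℂ (Mat N)) : Prop :=
  ∀ x ∈ A, Θ x ∈ A

/-- Graded commutation relations between (the subalgebras of) two disjoint regions: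
even elements of one commute with all elements of the other, odd elements anticommute. -/
def GradedComm (Θ : Mat N ≃⋆ₐ[ℂ] Mat N) (A C : StarSubalgebra ℂ (Mat N)) : Prop :=
  ∀ x ∈ A, ∀ y ∈ C,
    ((Θ x = x ∨ Θ y = y) → x * y = y * x) ∧
      (Θ x = -x → Θ y = -y → x * y + y * x = 0)

/-- `ω` is a state (positive normalized linear functional). -/
def IsState (ω : Mat N →ₗ[ℂ] ℂ) : Prop :=
  ω 1 = 1 ∧ ∀ x : Mat N, 0 ≤ ω (star x * x)

/-- Markov property of the state `ω` with respect to a triplet with first algebra `AA` and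
pair algebra `AB`: there is a quasi-conditional expectation (a completely positive map into
`AB` which is a module map over `AA`) fixing `AA` pointwise and preserving `ω`. -/
def IsMarkovState (AA AB : StarSubalgebra ℂ (Mat N)) (ω : Mat N →ₗ[ℂ] ℂ) : Prop :=
  ∃ E : Mat N →ₗ[ℂ] Mat N, IsCP E ∧ (∀ x, E x ∈ AB) ∧
    (∀ c ∈ AA, ∀ x, E (c * x) = c * E x) ∧ (∀ c ∈ AA, E c = c) ∧
    ∀ x, ω (E x) = ω x

/-- Markov property, formulated for the state with τ-density `ρ`. -/
def IsMarkovDensity (AA AB : StarSubalgebra ℂ (Mat N)) (ρ : Mat N) : Prop :=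
  ∃ E : Mat N →ₗ[ℂ] Mat N, IsCP E ∧ (∀ x, E x ∈ AB) ∧
    (∀ c ∈ AA, ∀ x, E (c * x) = c * E x) ∧ (∀ c ∈ AA, E c = c) ∧
    ∀ x, tau (ρ * E x) = tau (ρ * x)

/-- The restriction of `ω` to the subalgebra generated by `AA` and `AC` is separable:
a convex combination of product states for the pair `(AA, AC)`. -/
def SeparableOn (AA AC : StarSubalgebra ℂ (Mat N)) (ω : Mat N →ₗ[ℂ] ℂ) : Prop :=
  ∃ (n : ℕ) (lam : Fin n → ℝ) (ωi : Fin n → (Mat N →ₗ[ℂ] ℂ)),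
    (∀ i, 0 ≤ lam i) ∧ (∑ i, lam i = 1) ∧ (∀ i, IsState (ωi i)) ∧
    (∀ i, ∀ x ∈ AA, ∀ y ∈ AC, ωi i (x * y) = ωi i x * ωi i y) ∧
    ∀ z ∈ (AA ⊔ AC : StarSubalgebra ℂ (Mat N)), ω z = ∑ i, (lam i : ℂ) * ωi i z

/-- The conditional expectation `E` is sufficient for the pair of states with τ-densities
`ρ₁, ρ₂`: some completely positive trace-preserving (recovery) map `T` recovers the densities
from their compressions `E ρ₁`, `E ρ₂` (recall that the τ-density of `ψ ∘ E` is `E ρ_ψ`). -/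
def IsSufficient (E : Mat N →ₗ[ℂ] Mat N) (ρ₁ ρ₂ : Mat N) : Prop :=
  ∃ T : Mat N →ₗ[ℂ] Mat N, IsCP T ∧ (∀ x, (T x).trace = x.trace) ∧
    T (E ρ₁) = ρ₁ ∧ T (E ρ₂) = ρ₂

open Filter Topology

/-- If two finite positive measures on `(0, ∞)` have the same mass and comparable resolvent
integrals, then their logarithmic integrals are comparable. -/
lemma sum_mul_log_le_of_sum_div_add_le {ι κ : Type*} [Fintype ι] [Fintype κ]
    {c t : ι → ℝ} {d r : κ → ℝ} (ht : ∀ i, 0 < t i) (hr : ∀ k, 0 < r k)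
    (hcd : ∑ i, c i = ∑ k, d k)
    (h : ∀ s, 0 < s → ∑ k, d k / (r k + s) ≤ ∑ i, c i / (t i + s)) :
    ∑ i, c i * Real.log (t i) ≤ ∑ k, d k * Real.log (r k) := by
  set G : ℝ → ℝ := fun s =>
    ∑ i, c i * Real.log (t i + s) - ∑ k, d k * Real.log (r k + s) with hG
  have hderiv : ∀ s, 0 ≤ s →
      HasDerivAt G (∑ i, c i / (t i + s) - ∑ k, d k / (r k + s)) s := by
    intro s hs
    refine HasDerivAt.sub (HasDerivAt.fun_sum fun i _ => ?_) (HasDerivAt.fun_sum fun k _ => ?_)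
    · have := ((hasDerivAt_id s).const_add (t i)).log (by have := ht i; simp; linarith)
      simpa [div_eq_mul_inv] using this.const_mul (c i)
    · have := ((hasDerivAt_id s).const_add (r k)).log (by have := hr k; simp; linarith)
      simpa [div_eq_mul_inv] using this.const_mul (d k)
  have hmono : MonotoneOn G (Set.Ici 0) := by
    refine monotoneOn_of_deriv_nonneg (convex_Ici 0)
      (fun s hs => (hderiv s hs).continuousAt.continuousWithinAt) ?_ ?_
    · intro s hs
      rw [interior_Ici] at hs
      exact (hderiv s (le_of_lt hs)).differentiableAt.differentiableWithinAt
    · intro s hs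
      rw [interior_Ici] at hs
      rw [(hderiv s (le_of_lt hs)).deriv]
      exact sub_nonneg.2 (h s hs)
  have hlog : ∀ a : ℝ, Tendsto (fun s : ℝ => Real.log (a + s) - Real.log s) atTop (𝓝 0) := by
    intro a
    simpa [add_comm] using Real.tendsto_log_comp_add_sub_log a
  have hlim : Tendsto G atTop (𝓝 0) := by
    have h1 : Tendsto (fun s : ℝ => ∑ i, c i * (Real.log (t i + s) - Real.log s)
        - ∑ k, d k * (Real.log (r k + s) - Real.log s)) atTop (𝓝 (∑ i, c i * 0 - ∑ k, d k * 0)) :=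
      (tendsto_finsetSum _ fun i _ => (hlog (t i)).const_mul (c i)).sub
        (tendsto_finsetSum _ fun k _ => (hlog (r k)).const_mul (d k))
    simp only [mul_zero, Finset.sum_const_zero, sub_zero] at h1
    refine h1.congr fun s => ?_
    simp only [hG, mul_sub, Finset.sum_sub_distrib, ← Finset.sum_mul, hcd]
    ring
  have h0 : G 0 ≤ 0 := by
    refine ge_of_tendsto hlim ?_
    filter_upwards [eventually_ge_atTop 0] with s hs
    exact hmono (Set.mem_Ici.2 le_rfl) hs hs
  simpa [hG] using h0

/-- The matrix of `X` relative to eigenbases of the Hermitian matrices `σ` and `ρ`. -/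
noncomputable def eigenMatrix {σ ρ : Mat N} (hσ : σ.IsHermitian) (hρ : ρ.IsHermitian)
    (X : Mat N) : Mat N :=
  star (hσ.eigenvectorUnitary : Mat N) * X * (hρ.eigenvectorUnitary : Mat N)

lemma trace_star_mul_cfc_mul_cfc {σ ρ : Mat N} (hσ : σ.IsHermitian) (hρ : ρ.IsHermitian)
    (f g : ℝ → ℝ) (X Y : Mat N) :
    (star X * cfc f σ * Y * cfc g ρ).trace = ∑ j, ∑ i, star (eigenMatrix hσ hρ X j i) *
      eigenMatrix hσ hρ Y j i * (f (hσ.eigenvalues j) * g (hρ.eigenvalues i) : ℝ) := by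
  set U := (hρ.eigenvectorUnitary : Mat N) with hU
  set V := (hσ.eigenvectorUnitary : Mat N) with hV
  have h : (star X * cfc f σ * Y * cfc g ρ).trace =
      (star (eigenMatrix hσ hρ X) * (Matrix.diagonal fun j => (f (hσ.eigenvalues j) : ℂ)) *
        (eigenMatrix hσ hρ Y * Matrix.diagonal fun i => (g (hρ.eigenvalues i) : ℂ))).trace := by
    rw [hσ.cfc_eq, hρ.cfc_eq, Matrix.IsHermitian.cfc, Matrix.IsHermitian.cfc,
      Unitary.conjStarAlgAut_apply, Unitary.conjStarAlgAut_apply]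
    simp only [eigenMatrix, star_mul, star_star, ← hU, ← hV]
    rw [← mul_assoc, Matrix.trace_mul_comm]
    simp only [mul_assoc]
    rfl
  rw [h, Matrix.trace, Finset.sum_comm]
  refine Finset.sum_congr rfl fun i _ => ?_
  rw [Matrix.diag_apply, Matrix.mul_apply]
  refine Finset.sum_congr rfl fun j _ => ?_
  rw [Matrix.mul_diagonal, Matrix.mul_diagonal, Matrix.star_apply]
  push_cast
  ring

lemma trace_cfc {ρ : Mat N} (hρ : ρ.IsHermitian) (f : ℝ → ℝ) :
    (cfc f ρ).trace = (∑ i, f (hρ.eigenvalues i) : ℝ) := by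
  rw [hρ.cfc_eq, Matrix.IsHermitian.cfc, Unitary.conjStarAlgAut_apply, Matrix.trace_mul_comm,
    ← mul_assoc, Unitary.coe_star_mul_self, one_mul, Matrix.trace_diagonal]
  simp

/-- The resolvent function `s ↦ Tr ρ (L_σ + s R_ρ)⁻¹ ρ` in terms of eigenbases. -/
noncomputable def resolventSum {σ ρ : Mat N} (hσ : σ.IsHermitian) (hρ : ρ.IsHermitian)
    (s : ℝ) : ℝ :=
  ∑ j, ∑ i, Complex.normSq (eigenMatrix hσ hρ 1 j i) * hρ.eigenvalues i ^ 2 /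
    (hσ.eigenvalues j + s * hρ.eigenvalues i)

/-- The quadratic form whose maximum over `Y` is the resolvent function. -/
noncomputable def resolventForm (σ ρ Y : Mat N) (s : ℝ) : ℝ :=
  2 * (star Y * ρ).trace.re - (star Y * σ * Y).trace.re - s * (star Y * Y * ρ).trace.re

lemma resolventForm_eq_sum {σ ρ : Mat N} (hσ : σ.IsHermitian) (hρ : ρ.IsHermitian)
    (Y : Mat N) (s : ℝ) :
    resolventForm σ ρ Y s = ∑ j, ∑ i,
      (2 * (star (eigenMatrix hσ hρ Y j i) * eigenMatrix hσ hρ 1 j i).re * hρ.eigenvalues i -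
        Complex.normSq (eigenMatrix hσ hρ Y j i) *
          (hσ.eigenvalues j + s * hρ.eigenvalues i)) := by
  have hσ' : IsSelfAdjoint σ := hσ
  have hρ' : IsSelfAdjoint ρ := hρ
  have h1 := trace_star_mul_cfc_mul_cfc hσ hρ 1 id Y 1
  have h2 := trace_star_mul_cfc_mul_cfc hσ hρ id 1 Y Y
  have h3 := trace_star_mul_cfc_mul_cfc hσ hρ 1 id Y Y
  rw [cfc_one ℝ σ, cfc_id ℝ ρ, mul_one, mul_one] at h1
  rw [cfc_one ℝ ρ, cfc_id ℝ σ, mul_one] at h2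
  rw [cfc_one ℝ σ, cfc_id ℝ ρ, mul_one] at h3
  rw [resolventForm, h1, h2, h3]
  simp only [Complex.re_sum, Finset.mul_sum, ← Finset.sum_sub_distrib, Complex.re_mul_ofReal]
  refine Finset.sum_congr rfl fun j _ => Finset.sum_congr rfl fun i _ => ?_
  have h4 : ∀ z : ℂ, (star z * z).re = Complex.normSq z := fun z => by
    simp [Complex.normSq_apply]
  simp only [h4, Pi.one_apply, id]
  ring

lemma resolventForm_le {σ ρ : Mat N} (hσ : σ.PosDef) (hρ : ρ.PosDef) (Y : Mat N) {s : ℝ}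
    (hs : 0 < s) : resolventForm σ ρ Y s ≤ resolventSum hσ.1 hρ.1 s := by
  rw [resolventForm_eq_sum hσ.1 hρ.1, resolventSum]
  refine Finset.sum_le_sum fun j _ => Finset.sum_le_sum fun i _ => ?_
  have hp := hρ.eigenvalues_pos i
  have hq := hσ.eigenvalues_pos j
  set p := hρ.1.eigenvalues i
  set q := hσ.1.eigenvalues j
  have hD : 0 < q + s * p := by positivity
  rw [le_div_iff₀ hD]
  generalize eigenMatrix hσ.1 hρ.1 Y j i = y
  generalize eigenMatrix hσ.1 hρ.1 1 j i = c
  simp only [Complex.normSq_apply, Complex.mul_re, Complex.star_def, Complex.conj_re,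
    Complex.conj_im]
  nlinarith [sq_nonneg (y.re * (q + s * p) - c.re * p), sq_nonneg (y.im * (q + s * p) - c.im * p)]

lemma eigenMatrix_mul_left {σ ρ : Mat N} (hσ : σ.IsHermitian) (hρ : ρ.IsHermitian)
    (Y : Mat N) (j i : Fin N) :
    eigenMatrix hσ hρ (σ * Y) j i = hσ.eigenvalues j * eigenMatrix hσ hρ Y j i := by
  have h : star (hσ.eigenvectorUnitary : Mat N) * σ =
      Matrix.diagonal (fun k => (hσ.eigenvalues k : ℂ)) *
        star (hσ.eigenvectorUnitary : Mat N) := by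
    have h0 := hσ.conjStarAlgAut_star_eigenvectorUnitary
    rw [Unitary.conjStarAlgAut_star_apply] at h0
    have h1 : star (hσ.eigenvectorUnitary : Mat N) * σ * hσ.eigenvectorUnitary =
      Matrix.diagonal (fun k => (hσ.eigenvalues k : ℂ)) := h0
    rw [← h1, mul_assoc, (Unitary.mem_iff.1 hσ.eigenvectorUnitary.2).2, mul_one]
  rw [eigenMatrix, ← mul_assoc, h, mul_assoc, mul_assoc, Matrix.diagonal_mul, eigenMatrix,
    mul_assoc]

lemma eigenMatrix_mul_right {σ ρ : Mat N} (hσ : σ.IsHermitian) (hρ : ρ.IsHermitian)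
    (Y : Mat N) (j i : Fin N) :
    eigenMatrix hσ hρ (Y * ρ) j i = eigenMatrix hσ hρ Y j i * hρ.eigenvalues i := by
  have h : ρ * (hρ.eigenvectorUnitary : Mat N) = (hρ.eigenvectorUnitary : Mat N) *
      Matrix.diagonal (fun k => (hρ.eigenvalues k : ℂ)) := by
    have h0 := hρ.conjStarAlgAut_star_eigenvectorUnitary
    rw [Unitary.conjStarAlgAut_star_apply] at h0
    have h1 : star (hρ.eigenvectorUnitary : Mat N) * ρ * hρ.eigenvectorUnitary =
      Matrix.diagonal (fun k => (hρ.eigenvalues k : ℂ)) := h0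
    rw [← h1, ← mul_assoc, ← mul_assoc, (Unitary.mem_iff.1 hρ.eigenvectorUnitary.2).2, one_mul]
  rw [eigenMatrix, mul_assoc, mul_assoc, h, ← mul_assoc, ← mul_assoc, Matrix.mul_diagonal,
    eigenMatrix]

lemma eigenMatrix_add_smul {σ ρ : Mat N} (hσ : σ.IsHermitian) (hρ : ρ.IsHermitian)
    (X Y : Mat N) (s : ℂ) (j i : Fin N) :
    eigenMatrix hσ hρ (X + s • Y) j i =
      eigenMatrix hσ hρ X j i + s * eigenMatrix hσ hρ Y j i := by
  simp [eigenMatrix, mul_add, add_mul]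

lemma resolventForm_eq_of_sylvester {σ ρ Y : Mat N} (hσ : σ.PosDef) (hρ : ρ.PosDef) {s : ℝ}
    (hs : 0 < s) (hY : σ * Y + (s : ℂ) • (Y * ρ) = ρ) :
    resolventForm σ ρ Y s = resolventSum hσ.1 hρ.1 s := by
  rw [resolventForm_eq_sum hσ.1 hρ.1, resolventSum]
  refine Finset.sum_congr rfl fun j _ => Finset.sum_congr rfl fun i _ => ?_
  have hp := hρ.eigenvalues_pos i
  have hq := hσ.eigenvalues_pos j
  have h1 : eigenMatrix hσ.1 hρ.1 (σ * Y + (s : ℂ) • (Y * ρ)) j i =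
      eigenMatrix hσ.1 hρ.1 (1 * ρ) j i := by rw [hY, one_mul]
  rw [eigenMatrix_add_smul, eigenMatrix_mul_left, eigenMatrix_mul_right,
    eigenMatrix_mul_right] at h1
  set p := hρ.1.eigenvalues i
  set q := hσ.1.eigenvalues j
  have hD : 0 < q + s * p := by positivity
  generalize eigenMatrix hσ.1 hρ.1 Y j i = y at *
  generalize eigenMatrix hσ.1 hρ.1 1 j i = c at *
  have hy : y = c * ((p / (q + s * p) : ℝ) : ℂ) := by
    have hD' : ((q : ℂ) + s * p) ≠ 0 := by exact_mod_cast hD.ne'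
    push_cast
    field_simp
    linear_combination h1
  subst hy
  simp only [Complex.normSq_apply, Complex.mul_re, Complex.mul_im, Complex.star_def,
    Complex.conj_re, Complex.conj_im, Complex.ofReal_re, Complex.ofReal_im]
  field_simp
  ring

/-- The Sylvester operator `L_σ + s R_ρ` of positive definite matrices is injective. -/
lemma eq_zero_of_sylvester {σ ρ Y : Mat N} (hσ : σ.PosDef) (hρ : ρ.PosDef) {s : ℝ}
    (hs : 0 < s) (hY : σ * Y + (s : ℂ) • (Y * ρ) = 0) : Y = 0 := by
  have h0 : eigenMatrix hσ.1 hρ.1 Y = 0 := by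
    ext j i
    have hp := hρ.eigenvalues_pos i
    have hq := hσ.eigenvalues_pos j
    have h1 : eigenMatrix hσ.1 hρ.1 (σ * Y + (s : ℂ) • (Y * ρ)) j i = 0 := by
      rw [hY]; simp [eigenMatrix]
    rw [eigenMatrix_add_smul, eigenMatrix_mul_left, eigenMatrix_mul_right] at h1
    have hD : ((hσ.1.eigenvalues j : ℂ) + s * hρ.1.eigenvalues i) ≠ 0 := by
      have : 0 < hσ.1.eigenvalues j + s * hρ.1.eigenvalues i := by positivity
      exact_mod_cast this.ne'
    refine (mul_eq_zero.1 ?_).resolve_left hD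
    linear_combination h1
  have h2 : Y = hσ.1.eigenvectorUnitary * eigenMatrix hσ.1 hρ.1 Y *
      star (hρ.1.eigenvectorUnitary : Mat N) := by
    rw [eigenMatrix, ← mul_assoc, ← mul_assoc, (Unitary.mem_iff.1 hσ.1.eigenvectorUnitary.2).2,
      one_mul, mul_assoc, (Unitary.mem_iff.1 hρ.1.eigenvectorUnitary.2).2, mul_one]
  rw [h2, h0, mul_zero, zero_mul]

lemma exists_sylvester_mem {B : StarSubalgebra ℂ (Mat N)} {σ ρ : Mat N} (hσB : σ ∈ B)
    (hρB : ρ ∈ B) (hσ : σ.PosDef) (hρ : ρ.PosDef) {s : ℝ} (hs : 0 < s) :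
    ∃ Y ∈ B, σ * Y + (s : ℂ) • (Y * ρ) = ρ := by
  let L : B →ₗ[ℂ] B := LinearMap.mulLeft ℂ (⟨σ, hσB⟩ : B) +
    (s : ℂ) • LinearMap.mulRight ℂ (⟨ρ, hρB⟩ : B)
  have hL : Function.Injective L := by
    rw [injective_iff_map_eq_zero]
    intro Y hY
    exact Subtype.ext (eq_zero_of_sylvester hσ hρ hs (congrArg Subtype.val hY))
  have : FiniteDimensional ℂ B :=
    inferInstanceAs (FiniteDimensional ℂ (Subalgebra.toSubmodule B.toSubalgebra))
  obtain ⟨Y, hY⟩ := LinearMap.injective_iff_surjective.1 hL ⟨ρ, hρB⟩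
  exact ⟨Y, Y.2, congrArg Subtype.val hY⟩

lemma trace_re_mul_log {σ ρ : Mat N} (hσ : σ.PosDef) (hρ : ρ.PosDef) :
    ((ρ * mlog σ).trace - (ρ * mlog ρ).trace).re =
      ∑ x : Fin N × Fin N, Complex.normSq (eigenMatrix hσ.1 hρ.1 1 x.1 x.2) *
        hρ.1.eigenvalues x.2 *
          Real.log (hσ.1.eigenvalues x.1 / hρ.1.eigenvalues x.2) := by
  have hσ' : IsSelfAdjoint σ := hσ.1
  have hρ' : IsSelfAdjoint ρ := hρ.1
  have h1 := trace_star_mul_cfc_mul_cfc hσ.1 hρ.1 Real.log id 1 1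
  have h2 := trace_star_mul_cfc_mul_cfc hσ.1 hρ.1 1 (fun x => id x * Real.log x) 1 1
  have hlog : ContinuousOn Real.log (spectrum ℝ ρ) :=
    (ρ.finite_real_spectrum).continuousOn _
  rw [cfc_id ℝ ρ, star_one, one_mul, mul_one, Matrix.trace_mul_comm] at h1
  rw [cfc_one ℝ σ, cfc_mul id Real.log ρ, cfc_id ℝ ρ, star_one, one_mul, mul_one, one_mul] at h2
  rw [mlog, mlog, h1, h2, Fintype.sum_prod_type]
  simp only [← Finset.sum_sub_distrib, Complex.re_sum]
  refine Finset.sum_congr rfl fun j _ => Finset.sum_congr rfl fun i _ => ?_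
  rw [Real.log_div (hσ.eigenvalues_pos j).ne' (hρ.eigenvalues_pos i).ne', ← mul_sub,
    ← Complex.ofReal_sub, Complex.re_mul_ofReal]
  simp only [Complex.normSq_apply, Complex.mul_re, Complex.star_def, Complex.conj_re,
    Complex.conj_im, Pi.one_apply, id]
  ring

lemma trace_re_eq_sum {σ ρ : Mat N} (hσ : σ.PosDef) (hρ : ρ.PosDef) :
    ρ.trace.re = ∑ x : Fin N × Fin N,
      Complex.normSq (eigenMatrix hσ.1 hρ.1 1 x.1 x.2) * hρ.1.eigenvalues x.2 := by
  have hσ' : IsSelfAdjoint σ := hσ.1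
  have hρ' : IsSelfAdjoint ρ := hρ.1
  have h1 := trace_star_mul_cfc_mul_cfc hσ.1 hρ.1 1 id 1 1
  rw [cfc_id ℝ ρ, cfc_one ℝ σ, star_one, one_mul, one_mul, one_mul] at h1
  rw [h1, Fintype.sum_prod_type]
  simp only [Complex.re_sum]
  refine Finset.sum_congr rfl fun j _ => Finset.sum_congr rfl fun i _ => ?_
  rw [Complex.re_mul_ofReal]
  simp [Complex.normSq_apply]

lemma resolventSum_eq {σ ρ : Mat N} (hσ : σ.PosDef) (hρ : ρ.PosDef) {s : ℝ} (hs : 0 < s) :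
    resolventSum hσ.1 hρ.1 s = ∑ x : Fin N × Fin N,
      Complex.normSq (eigenMatrix hσ.1 hρ.1 1 x.1 x.2) * hρ.1.eigenvalues x.2 /
        (hσ.1.eigenvalues x.1 / hρ.1.eigenvalues x.2 + s) := by
  rw [resolventSum, Fintype.sum_prod_type]
  refine Finset.sum_congr rfl fun j _ => Finset.sum_congr rfl fun i _ => ?_
  have hp := hρ.eigenvalues_pos i
  have hq := hσ.eigenvalues_pos j
  field_simp

/-- Two positive definite matrices and their compressions to `B` under a conditional
expectation: the relative entropy does not increase. -/
lemma relative_entropy_monotone {B : StarSubalgebra ℂ (Mat N)} {E : Mat N →ₗ[ℂ] Mat N}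
    (hE : IsCondExp B E) {σ ρ : Mat N} (hσ : σ.PosDef) (hρ : ρ.PosDef)
    (hEσ : (E σ).PosDef) (hEρ : (E ρ).PosDef) :
    ((ρ * mlog σ).trace - (ρ * mlog ρ).trace).re ≤
      ((E ρ * mlog (E σ)).trace - (E ρ * mlog (E ρ)).trace).re := by
  rw [trace_re_mul_log hσ hρ, trace_re_mul_log hEσ hEρ]
  refine sum_mul_log_le_of_sum_div_add_le
    (fun x => div_pos (hσ.eigenvalues_pos _) (hρ.eigenvalues_pos _))
    (fun x => div_pos (hEσ.eigenvalues_pos _) (hEρ.eigenvalues_pos _)) ?_ fun s hs => ?_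
  · rw [← trace_re_eq_sum hσ hρ, ← trace_re_eq_sum hEσ hEρ]
    simpa using congrArg Complex.re (hE.2.2 ρ 1 (one_mem B))
  rw [← resolventSum_eq hσ hρ hs, ← resolventSum_eq hEσ hEρ hs]
  obtain ⟨Y, hYB, hY⟩ := exists_sylvester_mem (hE.1 σ) (hE.1 ρ) hEσ hEρ hs
  have hY' : star Y ∈ B := star_mem hYB
  rw [← resolventForm_eq_of_sylvester hEσ hEρ hs hY]
  refine le_trans (le_of_eq ?_) (resolventForm_le hσ hρ Y hs)
  have hc : ∀ Z : Mat N, (star Y * Z * Y).trace = (Y * star Y * Z).trace := fun Z => by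
    rw [Matrix.trace_mul_comm, ← mul_assoc]
  rw [resolventForm, resolventForm, hc, hc, ← hE.2.2 _ _ hY', ← hE.2.2 _ _ (mul_mem hYB hY'),
    ← hE.2.2 _ _ (mul_mem hY' hYB)]

lemma cfc_mem_starSubalgebra (B : StarSubalgebra ℂ (Mat N)) (f : ℝ → ℝ) {x : Mat N}
    (hx : x ∈ B) : cfc f x ∈ B := by
  have : IsClosed (B : Set (Mat N)) :=
    Submodule.closed_of_finiteDimensional (Subalgebra.toSubmodule B.toSubalgebra)
  exact cfc_mem (𝕜' := ℂ) f hx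

lemma IsCondExp.isHermitian {B : StarSubalgebra ℂ (Mat N)} {E : Mat N →ₗ[ℂ] Mat N}
    (hE : IsCondExp B E) {x : Mat N} (hx : x.IsHermitian) : (E x).IsHermitian := by
  have h1 : ∀ b ∈ B, (b * (star (E x) - E x)).trace = 0 := by
    intro b hb
    have h2 := congrArg star (hE.2.2 x (star b) (star_mem hb))
    rw [← Matrix.trace_conjTranspose, ← Matrix.trace_conjTranspose,
      ← Matrix.star_eq_conjTranspose, ← Matrix.star_eq_conjTranspose, star_mul, star_mul,
      star_star, Matrix.star_eq_conjTranspose, hx.eq, Matrix.trace_mul_comm,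
      Matrix.trace_mul_comm _ b] at h2
    rw [mul_sub, Matrix.trace_sub, ← h2, hE.2.2 x b hb, sub_self]
  have h3 := h1 (star (star (E x) - E x)) (star_mem (sub_mem (star_mem (hE.1 x)) (hE.1 x)))
  exact sub_eq_zero.1 (Matrix.trace_conjTranspose_mul_self_eq_zero_iff.1 h3)

lemma IsCondExp.posSemidef {B : StarSubalgebra ℂ (Mat N)} {E : Mat N →ₗ[ℂ] Mat N}
    (hE : IsCondExp B E) {x : Mat N} (hx : x.PosSemidef) : (E x).PosSemidef := by
  have hH := hE.isHermitian hx.1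
  have hS : IsSelfAdjoint (E x) := hH
  have hcont : ∀ f : ℝ → ℝ, ContinuousOn f (spectrum ℝ (E x)) := fun f =>
    (E x).finite_real_spectrum.continuousOn _
  set g : ℝ → ℝ := fun t => Real.sqrt (-t) with hg
  have hgB := cfc_mem_starSubalgebra B g (hE.1 x)
  have hgS : star (cfc g (E x)) = cfc g (E x) := cfc_predicate g (E x)
  have h1 : 0 ≤ (cfc g (E x) * cfc g (E x) * E x).trace := by
    rw [← hE.2.2 x _ (mul_mem hgB hgB), mul_assoc, Matrix.trace_mul_comm]
    have h := (hx.conjTranspose_mul_mul_same (cfc g (E x))).trace_nonneg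
    rwa [← Matrix.star_eq_conjTranspose, hgS] at h
  have h2 : cfc g (E x) * cfc g (E x) * E x = cfc (fun t => g t * g t * id t) (E x) := by
    rw [cfc_mul _ id (E x) (hcont _) (hcont _), cfc_mul g g (E x) (hcont _) (hcont _),
      cfc_id ℝ (E x)]
  rw [h2, trace_cfc hH, Complex.zero_le_real] at h1
  have h3 : ∀ t : ℝ, g t * g t * id t ≤ 0 := by
    intro t
    rcases le_total 0 t with h | h
    · simp [hg, Real.sqrt_eq_zero_of_nonpos (neg_nonpos.2 h)]
    · exact mul_nonpos_of_nonneg_of_nonpos (mul_self_nonneg _) h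
  have h4 := (Finset.sum_eq_zero_iff_of_nonpos fun i _ => h3 (hH.eigenvalues i)).1
    (le_antisymm (Finset.sum_nonpos fun i _ => h3 (hH.eigenvalues i)) h1)
  refine hH.posSemidef_iff_eigenvalues_nonneg.2 fun i => ?_
  by_contra! hneg
  have h5 := h4 i (Finset.mem_univ i)
  simp only [Pi.zero_apply] at hneg
  have h6 : 0 < g (hH.eigenvalues i) := Real.sqrt_pos.2 (by linarith)
  exact absurd h5 (mul_neg_of_pos_of_neg (mul_pos h6 h6) hneg).ne

lemma Shat_eq (ρ : Mat N) : Shat ρ = -(ρ * mlog ρ).trace.re / N := by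
  rw [Shat, tau, neg_div, Complex.div_natCast_re]

lemma trace_mul_mlog_add_smul {ρ : Mat N} (hρ : ρ.IsHermitian) (ε : ℝ) :
    ((ρ + (ε : ℂ) • 1) * mlog (ρ + (ε : ℂ) • 1)).trace.re =
      ∑ i, (hρ.eigenvalues i + ε) * Real.log (hρ.eigenvalues i + ε) := by
  have hS : IsSelfAdjoint ρ := hρ
  have h1 : ρ + (ε : ℂ) • 1 = cfc (fun t => id t + ε) ρ := by
    rw [cfc_add_const ε id ρ (ρ.finite_real_spectrum.continuousOn _), cfc_id ℝ ρ,
      Algebra.algebraMap_eq_smul_one, Complex.coe_smul]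
  have h2 : mlog (cfc (fun t => id t + ε) ρ) = cfc (fun t => Real.log (id t + ε)) ρ := by
    rw [mlog, ← cfc_comp' Real.log (fun t => id t + ε) ρ
      ((ρ.finite_real_spectrum.image _).continuousOn _)
      (ρ.finite_real_spectrum.continuousOn _)]
  rw [h1, h2, ← cfc_mul _ _ ρ (ρ.finite_real_spectrum.continuousOn _)
    (ρ.finite_real_spectrum.continuousOn _), trace_cfc hρ, Complex.ofReal_re]
  rfl

lemma tendsto_Shat_add_smul {ρ : Mat N} (hρ : ρ.IsHermitian) :
    Tendsto (fun ε : ℝ => Shat (ρ + (ε : ℂ) • 1)) (𝓝[>] 0) (𝓝 (Shat ρ)) := by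
  have h : Continuous fun ε : ℝ => Shat (ρ + (ε : ℂ) • 1) := by
    simp only [Shat_eq, trace_mul_mlog_add_smul hρ]
    refine (Continuous.neg (continuous_finsetSum _ fun i _ => ?_)).div_const _
    exact Real.continuous_mul_log.comp (continuous_const.add continuous_id)
  simpa using (h.tendsto 0).mono_left nhdsWithin_le_nhds

/-- Strong subadditivity of the entropy for a commuting square and a positive definite density. -/
lemma CommSquare.Shat_add_le {AB BC B : StarSubalgebra ℂ (Mat N)}
    {EAB EBC EB : Mat N →ₗ[ℂ] Mat N} (h : CommSquare AB BC B EAB EBC EB) {ρ : Mat N}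
    (hρ : ρ.PosDef) (hAB : (EAB ρ).PosDef) (hBC : (EBC ρ).PosDef) (hB : (EB ρ).PosDef) :
    Shat ρ + Shat (EB ρ) ≤ Shat (EAB ρ) + Shat (EBC ρ) := by
  obtain ⟨hEAB, hEBC, hEB, hinf, h1, h2⟩ := h
  have hmono := relative_entropy_monotone hEAB hBC hρ (by rwa [h1]) hAB
  rw [h1] at hmono
  have h3 : (ρ * mlog (EBC ρ)).trace = (EBC ρ * mlog (EBC ρ)).trace := by
    have hmem : mlog (EBC ρ) ∈ BC := cfc_mem_starSubalgebra BC _ (hEBC.1 ρ)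
    rw [Matrix.trace_mul_comm, hEBC.2.2 _ _ hmem, Matrix.trace_mul_comm]
  have h4 : (EAB ρ * mlog (EB ρ)).trace = (EB ρ * mlog (EB ρ)).trace := by
    have hmem : mlog (EB ρ) ∈ BC :=
      ((hinf ▸ cfc_mem_starSubalgebra B _ (hEB.1 ρ) : mlog (EB ρ) ∈ AB ⊓ BC)).2
    rw [Matrix.trace_mul_comm, hEBC.2.2 _ _ hmem, h2, Matrix.trace_mul_comm]
  rw [h3, h4, Complex.sub_re, Complex.sub_re] at hmono
  simp only [Shat_eq, ← add_div]
  exact div_le_div_of_nonneg_right (by linarith) (Nat.cast_nonneg N)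

lemma IsCondExp.map_add_smul_one {B : StarSubalgebra ℂ (Mat N)} {E : Mat N →ₗ[ℂ] Mat N}
    (hE : IsCondExp B E) (x : Mat N) (c : ℂ) : E (x + c • 1) = E x + c • 1 := by
  rw [map_add, map_smul, hE.2.1 1 (one_mem B)]

lemma posDef_add_smul_one {x : Mat N} (hx : x.PosSemidef) {ε : ℝ} (hε : 0 < ε) :
    (x + (ε : ℂ) • 1).PosDef :=
  Matrix.PosDef.posSemidef_add hx (Matrix.PosDef.one.smul (by exact_mod_cast hε))

/-- strong subadditivity of von Neumann entropy `S` for a state of a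
three-composed graded quantum system `(S_A, S_B, S_C)` generating the finite-dimensional
factor `Mat N`, with the commuting square condition and the product matrix-trace assumption
(encoded through the matrix sizes `kA, kB, kC` of the regions and `HasMatSize`). -/
theorem stmt1 {N kA kB kC : ℕ} (hkA : 0 < kA) (hkB : 0 < kB) (hkC : 0 < kC)
    (hN : N = kA * kB * kC)
    (Θ : Mat N ≃⋆ₐ[ℂ] Mat N) (hΘ : IsGrading Θ)
    (SA SB SC : StarSubalgebra ℂ (Mat N))
    (hAinv : ThetaInvariant Θ SA) (hBinv : ThetaInvariant Θ SB) (hCinv : ThetaInvariant Θ SC)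
    (hfA : IsFactorSub SA) (hfB : IsFactorSub SB) (hfC : IsFactorSub SC)
    (hABc : GradedComm Θ SA SB) (hACc : GradedComm Θ SA SC) (hBCc : GradedComm Θ SB SC)
    (hgen : SA ⊔ SB ⊔ SC = ⊤)
    (EAB EBC EB : Mat N →ₗ[ℂ] Mat N)
    (hsq : CommSquare (SA ⊔ SB) (SB ⊔ SC) SB EAB EBC EB)
    (hszAB : HasMatSize (SA ⊔ SB) (kA * kB)) (hszBC : HasMatSize (SB ⊔ SC) (kB * kC))
    (hszB : HasMatSize SB kB)
    (ρ : Mat N) (hρ : IsTauDensity ρ) :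
    Sres ρ N - Sres (EAB ρ) (kA * kB) - Sres (EBC ρ) (kB * kC) + Sres (EB ρ) kB ≤ 0 := by
  have hsq' := hsq
  obtain ⟨hEAB, hEBC, hEB, -⟩ := hsq'
  have hineq : Shat ρ + Shat (EB ρ) ≤ Shat (EAB ρ) + Shat (EBC ρ) := by
    refine le_of_tendsto_of_tendsto
      ((tendsto_Shat_add_smul hρ.1.1).add (tendsto_Shat_add_smul (hEB.posSemidef hρ.1).1))
      ((tendsto_Shat_add_smul (hEAB.posSemidef hρ.1).1).add
        (tendsto_Shat_add_smul (hEBC.posSemidef hρ.1).1)) ?_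
    filter_upwards [self_mem_nhdsWithin] with ε hε
    have h := hsq.Shat_add_le (posDef_add_smul_one hρ.1 hε)
    rw [hEAB.map_add_smul_one, hEBC.map_add_smul_one, hEB.map_add_smul_one] at h
    exact h (posDef_add_smul_one (hEAB.posSemidef hρ.1) hε)
      (posDef_add_smul_one (hEBC.posSemidef hρ.1) hε)
      (posDef_add_smul_one (hEB.posSemidef hρ.1) hε)
  have hA : (kA : ℝ) ≠ 0 := by positivity
  have hB : (kB : ℝ) ≠ 0 := by positivity
  have hC : (kC : ℝ) ≠ 0 := by positivity
  have hlogN : Real.log N = Real.log kA + Real.log kB + Real.log kC := by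
    rw [hN, Nat.cast_mul, Nat.cast_mul, Real.log_mul (mul_ne_zero hA hB) hC, Real.log_mul hA hB]
  simp only [Sres, Nat.cast_mul, Real.log_mul hA hB, Real.log_mul hB hC, hlogN]
  linarith
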